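/- arXiv:1007.4310 — 2 statements merged into one kernel-verified Lean document; each statement's English description precedes it below -/
import Mathlib

section
/- Lemma 3, part 3 (bound for Φ on the critical line, eq. (3.7)). Let κ be a positive integer. There is a constant C = C(κ) such that for all σ ∈ [1/2, 1], all t ≥ 3, s = σ + it, and all real v, writing w = 1/2 + iv: |Φ(w; s, τ(t))| ≤ C·t^{2−4σ}·min(1, |w−s|²/t). -/
open Complex

/-- The gamma-factor `X(s) = (2π)^{4s-2} Γ(κ-s) Γ(1-s) / (Γ(s+κ-1) Γ(s))`. -/
noncomputable def RSX (κ : ℕ) (s : ℂ) : ℂ :=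
  (2 * (Real.pi : ℂ)) ^ (4 * s - 2) * Complex.Gamma ((κ : ℂ) - s) * Complex.Gamma (1 - s) /
    (Complex.Gamma (s + (κ : ℂ) - 1) * Complex.Gamma s)

/-- `log τ(t) = Re(-X'(1/2+it)/X(1/2+it))`; the quantity `-X'/X(1/2+it)` is real. -/
noncomputable def RSlogTau (κ : ℕ) (t : ℝ) : ℝ :=
  (-(deriv (RSX κ) (1 / 2 + Complex.I * t) / RSX κ (1 / 2 + Complex.I * t))).re

/-- `Φ(w; s, τ(t)) = τ(t)^{w-s} X(w) - X(s)`, with `τ(t)^{w-s} = exp((w-s) log τ(t))`. -/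
noncomputable def RSPhi (κ : ℕ) (w s : ℂ) (t : ℝ) : ℂ :=
  Complex.exp ((w - s) * (RSlogTau κ t : ℂ)) * RSX κ w - RSX κ s

theorem norm_sub_le_of_hasDerivAt_mul {h g : ℂ → ℂ} {a b : ℂ} {G : ℝ}
    (hd : ∀ z ∈ segment ℝ a b, HasDerivAt h (h z * g z) z)
    (hg : ∀ z ∈ segment ℝ a b, ‖g z‖ ≤ G) :
    ‖h b - h a‖ ≤ ‖h a‖ * (Real.exp (G * ‖b - a‖) - 1) := by
  have hG : 0 ≤ G := (norm_nonneg _).trans (hg a (left_mem_segment ℝ a b))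
  rcases eq_or_ne (G * ‖b - a‖) 0 with h0 | h0
  · by_cases hab : a = b
    · subst hab; simp
    · have hG0 : G = 0 := (mul_eq_zero.1 h0).resolve_right
        (by simpa [sub_eq_zero] using Ne.symm hab)
      have := (convex_segment a b).norm_image_sub_le_of_norm_hasDerivWithin_le (C := 0)
        (fun z hz => (hd z hz).hasDerivWithinAt)
        (fun z hz => by
          have := hg z hz
          rw [hG0] at this
          rw [norm_mul, le_antisymm this (norm_nonneg _), mul_zero])
        (left_mem_segment ℝ a b) (right_mem_segment ℝ a b)
      simpa [hG0] using this
  · set c : ℝ → ℂ := fun x => a + (x : ℂ) * (b - a) with hc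
    have hcmem : ∀ x ∈ Set.Icc (0 : ℝ) 1, c x ∈ segment ℝ a b := by
      intro x hx
      rw [segment_eq_image']
      exact ⟨x, hx, by simp [hc]⟩
    have hcd : ∀ x : ℝ, HasDerivAt c (b - a) x := by
      intro x
      exact (((hasDerivAt_id x).ofReal_comp.mul_const (b - a)).const_add a).congr_deriv (by simp)
    have hf : ∀ x ∈ Set.Icc (0 : ℝ) 1,
        HasDerivAt (fun x => h (c x) - h a) (h (c x) * g (c x) * (b - a)) x := by
      intro x hx
      exact ((hd _ (hcmem x hx)).comp x (hcd x)).sub_const _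
    have key := norm_le_gronwallBound_of_norm_deriv_right_le (δ := 0) (K := G * ‖b - a‖)
      (ε := G * ‖b - a‖ * ‖h a‖) (a := 0) (b := 1)
      (fun x hx => (hf x hx).continuousAt.continuousWithinAt)
      (fun x hx => (hf x (Set.Ico_subset_Icc_self hx)).hasDerivWithinAt)
      (by simp [hc])
      (by
        intro x hx
        have h1 := hg _ (hcmem x (Set.Ico_subset_Icc_self hx))
        have h2 : ‖h (c x)‖ ≤ ‖h (c x) - h a‖ + ‖h a‖ := by
          simpa using norm_add_le (h (c x) - h a) (h a)
        rw [norm_mul, norm_mul]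
        calc ‖h (c x)‖ * ‖g (c x)‖ * ‖b - a‖
            ≤ (‖h (c x) - h a‖ + ‖h a‖) * G * ‖b - a‖ := by gcongr
          _ = _ := by ring)
      1 (by simp)
    rw [gronwallBound_of_K_ne_0 h0] at key
    have e : c 1 = b := by simp [hc]
    simp only [e] at key
    refine key.trans (le_of_eq ?_)
    rw [mul_div_cancel_left₀ _ h0]
    simp

theorem norm_logStep_sub_inv_le {z : ℂ} {R : ℝ} (hz : -(1 / 2) < z.re) (hR : ‖z‖ ≤ R) (k : ℕ) :
    ‖((Real.log (k + 1) - Real.log k : ℝ) : ℂ) - (z + k + 1)⁻¹‖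
      ≤ (2 + 2 * R) * (1 / ((k : ℝ) + 1) ^ 2) := by
  have hk : (0 : ℝ) ≤ k := k.cast_nonneg
  have hre : (k : ℝ) + 1 / 2 ≤ ‖z + k + 1‖ := by
    refine le_trans ?_ (Complex.re_le_norm _)
    simp; linarith
  have hne : z + k + 1 ≠ 0 := norm_pos_iff.1 (by linarith)
  have hne' : ((k : ℂ) + 1) ≠ 0 := Nat.cast_add_one_ne_zero k
  have h1 : |Real.log (k + 1) - Real.log k - 1 / ((k : ℝ) + 1)| ≤ 2 * (1 / ((k : ℝ) + 1) ^ 2) := by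
    rcases Nat.eq_zero_or_pos k with rfl | hkp
    · norm_num
    · have hkp' : (1 : ℝ) ≤ k := by exact_mod_cast hkp
      have e : Real.log (k + 1) - Real.log k = Real.log ((k + 1) / k) := by
        rw [Real.log_div (by positivity) (by positivity)]
      have u := Real.log_le_sub_one_of_pos (x := ((k : ℝ) + 1) / k) (by positivity)
      have l := Real.one_sub_inv_le_log_of_pos (x := ((k : ℝ) + 1) / k) (by positivity)
      have e1 : (1 : ℝ) - (((k : ℝ) + 1) / k)⁻¹ = 1 / ((k : ℝ) + 1) := by field_simp; ring
      have e2 : ((k : ℝ) + 1) / k - 1 = 1 / k := by field_simp; ring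
      rw [e, abs_of_nonneg (by linarith)]
      have : 1 / (k : ℝ) - 1 / (k + 1) ≤ 2 * (1 / ((k : ℝ) + 1) ^ 2) := by
        rw [div_sub_div _ _ (by positivity) (by positivity), ← mul_div_assoc,
          div_le_div_iff₀ (by positivity) (by positivity)]
        nlinarith
      linarith
  have h2 : ‖((k : ℂ) + 1)⁻¹ - (z + k + 1)⁻¹‖ ≤ 2 * R * (1 / ((k : ℝ) + 1) ^ 2) := by
    have e : ((k : ℂ) + 1)⁻¹ - (z + k + 1)⁻¹ = z / (((k : ℂ) + 1) * (z + k + 1)) := by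
      field_simp; ring
    have n1 : ‖(k : ℂ) + 1‖ = k + 1 := by
      rw [← Nat.cast_add_one, Complex.norm_natCast]; simp
    rw [e, norm_div, norm_mul, n1]
    have hR0 : 0 ≤ R := (norm_nonneg _).trans hR
    calc ‖z‖ / ((k + 1) * ‖z + k + 1‖) ≤ R / ((k + 1) * (((k : ℝ) + 1) / 2)) := by
          gcongr; linarith
      _ = _ := by field_simp
  calc _ = ‖((Real.log (k + 1) - Real.log k - 1 / ((k : ℝ) + 1) : ℝ) : ℂ)
          + (((k : ℂ) + 1)⁻¹ - (z + k + 1)⁻¹)‖ := by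
        congr 1; push_cast; rw [one_div]; ring
    _ ≤ _ := (norm_add_le _ _).trans (by
        rw [Complex.norm_real, Real.norm_eq_abs]; linarith)

theorem hasSum_digamma {z : ℂ} (hz : -(1 / 2) < z.re) (hz0 : z ≠ 0) :
    HasSum (fun k : ℕ => ((Real.log (k + 1) - Real.log k : ℝ) : ℂ) - (z + k + 1)⁻¹)
      (Complex.digamma z + z⁻¹) := by
  set R : ℝ := ‖z‖ + 1
  set t : Set ℂ := {w | -(1 / 2) < w.re} ∩ Metric.ball 0 R
  have ht_open : IsOpen t :=
    (isOpen_lt continuous_const Complex.continuous_re).inter Metric.isOpen_ball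
  have ht_conn : IsPreconnected t :=
    ((convex_halfSpace_re_gt _).inter (convex_ball _ _)).isPreconnected
  have hzt : z ∈ t := ⟨hz, by simp [R]⟩
  have h0t : (0 : ℂ) ∈ t := ⟨by simp, by simp [R]; positivity⟩
  have hu : Summable fun k : ℕ => (2 + 2 * R) * (1 / ((k : ℝ) + 1) ^ 2) := by
    have := (summable_nat_add_iff 1).2 (Real.summable_one_div_nat_pow.2 one_lt_two)
    simpa using this.mul_left (2 + 2 * R)
  set a : ℕ → ℂ → ℂ := fun k w =>
    w * ((Real.log (k + 1) - Real.log k : ℝ) : ℂ) - Complex.log (w + k + 1)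
      + (Real.log (k + 1) : ℂ) with ha
  have hslit : ∀ w ∈ t, ∀ k : ℕ, w + k + 1 ∈ Complex.slitPlane := by
    intro w hw k
    left
    have := hw.1
    have hk : (0 : ℝ) ≤ k := k.cast_nonneg
    simp only [Set.mem_ofPred_eq] at this
    simp; linarith
  have hd : ∀ (k : ℕ) (w : ℂ), w ∈ t → HasDerivAt (a k)
      (((Real.log (k + 1) - Real.log k : ℝ) : ℂ) - (w + k + 1)⁻¹) w := by
    intro k w hw
    have h1 : HasDerivAt (fun w : ℂ => w + k + 1) 1 w := by
      simpa using ((hasDerivAt_id w).add_const (k : ℂ)).add_const 1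
    exact ((((hasDerivAt_id w).mul_const ((Real.log (k + 1) - Real.log k : ℝ) : ℂ)).sub
      (h1.clog (hslit w hw k))).add_const (Real.log (k + 1) : ℂ)).congr_deriv (by simp)
  have hb : ∀ (k : ℕ) (w : ℂ), w ∈ t → ‖((Real.log (k + 1) - Real.log k : ℝ) : ℂ)
      - (w + k + 1)⁻¹‖ ≤ (2 + 2 * R) * (1 / ((k : ℝ) + 1) ^ 2) := fun k w hw =>
    norm_logStep_sub_inv_le hw.1 (by simpa using hw.2.out.le) k
  have ha0 : Summable fun k => a k 0 := by
    have : (fun k => a k 0) = fun _ => 0 := by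
      ext k
      simp only [ha]
      rw [Complex.ofReal_log (by positivity)]
      simp
    rw [this]; exact summable_zero
  have hA := hasDerivAt_tsum_of_isPreconnected hu ht_open ht_conn hd hb h0t ha0 hzt
  have hsum : ∀ w ∈ t, Summable fun k => a k w := fun w hw =>
    summable_of_summable_hasDerivAt_of_isPreconnected hu ht_open ht_conn hd hb h0t ha0 hw
  have hexp : ∀ w ∈ t, w ≠ 0 → Complex.Gamma w = Complex.exp (∑' k, a k w) / w := by
    intro w hw hw0
    rw [eq_div_iff hw0]
    have l1 := (Complex.continuous_exp.tendsto _).comp (hsum w hw).hasSum.tendsto_sum_nat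
    have l2 := (Complex.GammaSeq_tendsto_Gamma w).mul_const w
    refine tendsto_nhds_unique l2 (l1.congr' ?_)
    filter_upwards [Filter.eventually_gt_atTop 0] with n hn
    have hp : ∀ m : ℕ, Complex.exp (∑ k ∈ Finset.range m, a k w)
        = Complex.exp (w * (Real.log m : ℂ)) * m.factorial
          / ∏ k ∈ Finset.range m, (w + k + 1) := by
      intro m
      induction m with
      | zero => simp
      | succ m ih =>
        rw [Finset.sum_range_succ, Complex.exp_add, ih, Finset.prod_range_succ, Nat.factorial_succ]
        simp only [ha]
        rw [Complex.exp_add, Complex.exp_sub,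
          Complex.exp_log (Complex.slitPlane_ne_zero (hslit w hw m)),
          ← Complex.ofReal_exp (Real.log (m + 1)), Real.exp_log (by positivity)]
        have : Complex.exp (w * ((Real.log ((m + 1 : ℕ) : ℝ) : ℝ) : ℂ))
            = Complex.exp (w * (Real.log m : ℂ)) *
              Complex.exp (w * ((Real.log (m + 1) - Real.log m : ℝ) : ℂ)) := by
          rw [← Complex.exp_add]; congr 1; push_cast; ring
        rw [this]
        push_cast
        field_simp
    simp only [Function.comp]
    rw [hp, Complex.GammaSeq, Finset.prod_range_succ', Complex.cpow_def_of_ne_zero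
      (by exact_mod_cast hn.ne'), ← Complex.natCast_log, mul_comm w]
    have e : ∀ k ∈ Finset.range n, w + ((k + 1 : ℕ) : ℂ) = w + k + 1 := by
      intro k _; push_cast; ring
    rw [Finset.prod_congr rfl e]
    have : ∏ k ∈ Finset.range n, (w + k + 1) ≠ 0 :=
      Finset.prod_ne_zero_iff.2 fun k _ => Complex.slitPlane_ne_zero (hslit w hw k)
    push_cast
    rw [add_zero]
    field_simp
  have hev : Complex.Gamma =ᶠ[nhds z] fun w => Complex.exp (∑' k, a k w) / w := by
    filter_upwards [ht_open.mem_nhds hzt, isOpen_ne.mem_nhds hz0] with w h1 h2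
    exact hexp w h1 h2
  have hG := ((hA.cexp.div (hasDerivAt_id z) hz0).congr_of_eventuallyEq hev).deriv
  have hdig : Complex.digamma z + z⁻¹ = ∑' k : ℕ,
      (((Real.log (k + 1) - Real.log k : ℝ) : ℂ) - (z + k + 1)⁻¹) := by
    rw [Complex.digamma_def, logDeriv_apply, hG, hexp z hzt hz0]
    have := Complex.exp_ne_zero (∑' k, a k z)
    simp only [id]
    field_simp
    ring
  rw [hdig]
  exact (Summable.of_norm_bounded hu fun k => hb k z hzt).hasSum

theorem tendsto_digamma {z : ℂ} (hz : -(1 / 2) < z.re) (hz0 : z ≠ 0) :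
    Filter.Tendsto (fun n : ℕ => (Real.log n : ℂ) - ∑ k ∈ Finset.range (n + 1), (z + k)⁻¹)
      Filter.atTop (nhds (Complex.digamma z)) := by
  have h := (hasSum_digamma hz hz0).tendsto_sum_nat.sub_const z⁻¹
  rw [add_sub_cancel_right] at h
  refine h.congr fun n => ?_
  have h1 : ∑ k ∈ Finset.range n, ((Real.log (k + 1) - Real.log k : ℝ) : ℂ) = Real.log n := by
    have := Finset.sum_range_sub (fun k : ℕ => Real.log k) n
    push_cast at this
    rw [← Complex.ofReal_sum, this]
    simp
  rw [Finset.sum_sub_distrib, Finset.sum_range_succ', h1]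
  push_cast
  simp only [add_assoc, add_zero]
  ring

theorem digamma_conj {z : ℂ} (hz : -(1 / 2) < z.re) (hz0 : z ≠ 0) :
    Complex.digamma ((starRingEnd ℂ) z) = (starRingEnd ℂ) (Complex.digamma z) := by
  have h1 := (Complex.continuous_conj.tendsto _).comp (tendsto_digamma hz hz0)
  have h2 := tendsto_digamma (z := (starRingEnd ℂ) z) (by simpa using hz) (by simpa using hz0)
  refine tendsto_nhds_unique h2 (h1.congr fun n => ?_)
  simp only [Function.comp, map_sub, map_sum, map_inv₀, map_add, Complex.conj_ofReal, map_natCast]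

theorem add_le_two_mul_norm_add_natCast {z : ℂ} {T : ℝ} (hT : 0 ≤ T) (hz : 0 ≤ z.re)
    (hi : T ≤ |z.im|) (k : ℕ) : (T + k) ^ 2 ≤ 2 * ‖z + k‖ ^ 2 := by
  have hk : (0 : ℝ) ≤ k := k.cast_nonneg
  rw [Complex.sq_norm, Complex.normSq_apply]
  have h2 : T ^ 2 ≤ z.im ^ 2 := by rw [← sq_abs z.im]; gcongr
  simp
  nlinarith [sq_nonneg (T - k), mul_nonneg hz hk]

theorem norm_digamma_sub_le {z w : ℂ} {T : ℝ} (hT : 1 ≤ T) (hz : 0 ≤ z.re) (hw : 0 ≤ w.re)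
    (hzi : T ≤ |z.im|) (hwi : T ≤ |w.im|) :
    ‖Complex.digamma z - Complex.digamma w‖ ≤ 4 / T * ‖z - w‖ := by
  have ne : ∀ u : ℂ, T ≤ |u.im| → ∀ k : ℕ, u + k ≠ 0 := by
    intro u hu k h
    have := congrArg Complex.im h
    simp at this
    rw [this] at hu
    simp at hu
    linarith
  have hz0 : z ≠ 0 := by simpa using ne z hzi 0
  have hw0 : w ≠ 0 := by simpa using ne w hwi 0
  have lim := ((tendsto_digamma (by linarith) hz0).sub (tendsto_digamma (by linarith) hw0)).norm
  refine le_of_tendsto lim (Filter.Eventually.of_forall fun n => ?_)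
  have e : (Real.log n : ℂ) - ∑ k ∈ Finset.range (n + 1), (z + k)⁻¹
      - ((Real.log n : ℂ) - ∑ k ∈ Finset.range (n + 1), (w + k)⁻¹)
      = ∑ k ∈ Finset.range (n + 1), (z - w) / ((z + k) * (w + k)) := by
    rw [sub_sub_sub_cancel_left, ← Finset.sum_sub_distrib]
    refine Finset.sum_congr rfl fun k _ => ?_
    have := ne z hzi k
    have := ne w hwi k
    field_simp
    ring
  rw [e]
  have term : ∀ k ∈ Finset.range (n + 1), ‖(z - w) / ((z + k) * (w + k))‖
      ≤ ‖z - w‖ * 4 * (1 / (T + k) - 1 / (T + (k + 1 : ℕ))) := by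
    intro k _
    have hk : (0 : ℝ) ≤ k := k.cast_nonneg
    have a1 := add_le_two_mul_norm_add_natCast (by linarith) hz hzi k
    have a2 := add_le_two_mul_norm_add_natCast (by linarith) hw hwi k
    have a3 : (T + k) ^ 2 ≤ 2 * (‖z + k‖ * ‖w + k‖) := by
      refine le_of_sq_le_sq ?_ (by positivity)
      calc ((T + k) ^ 2) ^ 2 = (T + k) ^ 2 * (T + k) ^ 2 := by ring
        _ ≤ (2 * ‖z + k‖ ^ 2) * (2 * ‖w + k‖ ^ 2) := by gcongr
        _ = _ := by ring
    have a4 : 0 < ‖z + k‖ * ‖w + k‖ :=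
      mul_pos (norm_pos_iff.2 (ne z hzi k)) (norm_pos_iff.2 (ne w hwi k))
    rw [norm_div, norm_mul, mul_assoc, div_eq_mul_one_div]
    gcongr
    rw [div_sub_div _ _ (by positivity) (by positivity), mul_div_assoc',
      div_le_div_iff₀ a4 (by positivity)]
    push_cast
    nlinarith
  refine (norm_sum_le _ _).trans ((Finset.sum_le_sum term).trans ?_)
  rw [← Finset.mul_sum, Finset.sum_range_sub' (fun k : ℕ => 1 / (T + (k : ℝ)))]
  have : 0 ≤ 1 / (T + ((n + 1 : ℕ) : ℝ)) := by positivity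
  calc ‖z - w‖ * 4 * (1 / (T + ((0 : ℕ) : ℝ)) - 1 / (T + ((n + 1 : ℕ) : ℝ)))
      ≤ ‖z - w‖ * 4 * (1 / (T + ((0 : ℕ) : ℝ))) := by gcongr; linarith
    _ = _ := by simp; ring

theorem log_sub_three_le_re_digamma {z : ℂ} {T : ℝ} (hT : 1 ≤ T) (hz : 0 ≤ z.re)
    (hzi : T ≤ |z.im|) : Real.log T - 3 ≤ (Complex.digamma z).re := by
  have hz0 : z ≠ 0 := by
    rintro rfl
    simp at hzi; linarith
  have lim := (Complex.continuous_re.tendsto _).comp (tendsto_digamma (by linarith) hz0)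
  refine ge_of_tendsto lim ?_
  set m := ⌈T⌉₊
  have hm1 : T ≤ m := Nat.le_ceil T
  have hm2 : (m : ℝ) < T + 1 := Nat.ceil_lt_add_one (by linarith)
  have bT : ∀ k : ℕ, ((z + k)⁻¹).re ≤ 1 / T := by
    intro k
    refine (Complex.re_le_norm _).trans ?_
    rw [norm_inv, ← one_div]
    gcongr
    refine hzi.trans ?_
    simpa using Complex.abs_im_le_norm (z + k)
  have bk : ∀ k : ℕ, 1 ≤ k → ((z + ((k + 1 : ℕ) : ℂ))⁻¹).re ≤ Real.log (k + 1) - Real.log k := by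
    intro k hk
    have hk' : (1 : ℝ) ≤ k := by exact_mod_cast hk
    have h1 : ((z + ((k + 1 : ℕ) : ℂ))⁻¹).re ≤ 1 / ((k : ℝ) + 1) := by
      refine (Complex.re_le_norm _).trans ?_
      rw [norm_inv, ← one_div]
      gcongr
      refine le_trans ?_ (Complex.re_le_norm _)
      simpa using hz
    have l := Real.one_sub_inv_le_log_of_pos (x := ((k : ℝ) + 1) / k) (by positivity)
    have e1 : (1 : ℝ) - (((k : ℝ) + 1) / k)⁻¹ = 1 / ((k : ℝ) + 1) := by field_simp; ring
    rw [Real.log_div (by positivity) (by positivity)] at l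
    linarith
  have hmpos : 1 ≤ m := by exact_mod_cast hT.trans hm1
  have main : ∀ n : ℕ, m ≤ n → (∑ k ∈ Finset.range (n + 1), (z + k)⁻¹).re
      ≤ (m + 1) * (1 / T) + (Real.log n - Real.log m) := by
    intro n hn
    induction n, hn using Nat.le_induction with
    | base =>
      rw [Complex.re_sum]
      refine (Finset.sum_le_sum fun k _ => bT k).trans ?_
      simp
    | succ n hn ih =>
      rw [Finset.sum_range_succ, Complex.add_re]
      have := bk n (hmpos.trans hn)
      push_cast at this ih ⊢
      linarith
  filter_upwards [Filter.eventually_ge_atTop m] with n hn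
  have h1 := main n hn
  have h2 : ((m : ℝ) + 1) * (1 / T) ≤ 3 := by
    rw [mul_one_div, div_le_iff₀ (by linarith)]; linarith
  have h3 : Real.log T ≤ Real.log m := Real.log_le_log (by linarith) hm1
  simp only [Function.comp, Complex.sub_re, Complex.ofReal_re]
  linarith

/-- The logarithmic derivative of `RSX κ`, in terms of the digamma function. -/
noncomputable def RSXLogDeriv (κ : ℕ) (z : ℂ) : ℂ :=
  4 * (Real.log (2 * Real.pi) : ℂ) - (Complex.digamma ((κ : ℂ) - z) + Complex.digamma (1 - z)
    + Complex.digamma (z + (κ : ℂ) - 1) + Complex.digamma z)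

theorem ne_neg_natCast_of_im_ne_zero {z : ℂ} (hz : z.im ≠ 0) (m : ℕ) : z ≠ -m := by
  rintro rfl
  simp at hz

theorem hasDerivAt_Gamma_of_im_ne_zero {z : ℂ} (hz : z.im ≠ 0) :
    HasDerivAt Complex.Gamma (Complex.Gamma z * Complex.digamma z) z := by
  have h := ne_neg_natCast_of_im_ne_zero hz
  have := (Complex.differentiableAt_Gamma z h).hasDerivAt
  rwa [Complex.digamma_def, logDeriv_apply, mul_div_cancel₀ _ (Complex.Gamma_ne_zero h)]

theorem hasDerivAt_RSX (κ : ℕ) {z : ℂ} (hz : z.im ≠ 0) :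
    HasDerivAt (RSX κ) (RSX κ z * RSXLogDeriv κ z) z := by
  have i1 : ((κ : ℂ) - z).im ≠ 0 := by simpa using hz
  have i2 : (1 - z).im ≠ 0 := by simpa using hz
  have i3 : (z + (κ : ℂ) - 1).im ≠ 0 := by simpa using hz
  have n3 := Complex.Gamma_ne_zero (ne_neg_natCast_of_im_ne_zero i3)
  have n4 := Complex.Gamma_ne_zero (ne_neg_natCast_of_im_ne_zero hz)
  have hpi : (2 * (Real.pi : ℂ)) ≠ 0 := by simp [Real.pi_ne_zero]
  have d0 : HasDerivAt (fun z : ℂ => 4 * z - 2) 4 z := by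
    simpa using ((hasDerivAt_id z).const_mul (4 : ℂ)).sub_const 2
  have d1 := (hasDerivAt_Gamma_of_im_ne_zero i1).comp z ((hasDerivAt_id z).const_sub (κ : ℂ))
  have d2 := (hasDerivAt_Gamma_of_im_ne_zero i2).comp z ((hasDerivAt_id z).const_sub (1 : ℂ))
  have d3 := (hasDerivAt_Gamma_of_im_ne_zero i3).comp z
    (((hasDerivAt_id z).add_const (κ : ℂ)).sub_const (1 : ℂ))
  have d4 := hasDerivAt_Gamma_of_im_ne_zero hz
  have d := (((d0.const_cpow (c := 2 * (Real.pi : ℂ)) (Or.inl hpi)).mul d1).mul d2).div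
    (d3.mul d4) (mul_ne_zero n3 n4)
  refine d.congr_deriv ?_
  have hl : Complex.log (2 * (Real.pi : ℂ)) = (Real.log (2 * Real.pi) : ℂ) := by
    rw [Complex.ofReal_log (by positivity)]
    push_cast; rfl
  simp only [RSX, RSXLogDeriv, hl, Pi.mul_apply, Function.comp, id] at n3 n4 ⊢
  field_simp
  ring

theorem norm_RSXLogDeriv_sub_le {κ : ℕ} (hκ : 0 < κ) {z w : ℂ} {T : ℝ} (hT : 1 ≤ T)
    (hz0 : 0 ≤ z.re) (hz1 : z.re ≤ 1) (hw0 : 0 ≤ w.re) (hw1 : w.re ≤ 1)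
    (hzi : T ≤ |z.im|) (hwi : T ≤ |w.im|) :
    ‖RSXLogDeriv κ z - RSXLogDeriv κ w‖ ≤ 16 / T * ‖z - w‖ := by
  have hk : (1 : ℝ) ≤ κ := by exact_mod_cast hκ
  have b1 := norm_digamma_sub_le (z := κ - z) (w := κ - w) hT (by simp; linarith)
    (by simp; linarith) (by simpa using hzi) (by simpa using hwi)
  have b2 := norm_digamma_sub_le (z := 1 - z) (w := 1 - w) hT (by simp; linarith)
    (by simp; linarith) (by simpa using hzi) (by simpa using hwi)
  have b3 := norm_digamma_sub_le (z := z + κ - 1) (w := w + κ - 1) hT (by simp; linarith)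
    (by simp; linarith) (by simpa using hzi) (by simpa using hwi)
  have b4 := norm_digamma_sub_le hT hz0 hw0 hzi hwi
  rw [sub_sub_sub_cancel_left, norm_sub_rev w z] at b1 b2
  rw [show z + (κ : ℂ) - 1 - (w + κ - 1) = z - w by ring] at b3
  have e : RSXLogDeriv κ z - RSXLogDeriv κ w
      = -(((Complex.digamma (κ - z) - Complex.digamma (κ - w))
        + (Complex.digamma (1 - z) - Complex.digamma (1 - w)))
        + ((Complex.digamma (z + κ - 1) - Complex.digamma (w + κ - 1))
        + (Complex.digamma z - Complex.digamma w))) := by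
    simp only [RSXLogDeriv]; ring
  rw [e, norm_neg]
  refine (norm_add_le _ _).trans ((add_le_add (norm_add_le _ _) (norm_add_le _ _)).trans ?_)
  calc _ ≤ (4 / T * ‖z - w‖ + 4 / T * ‖z - w‖) + (4 / T * ‖z - w‖ + 4 / T * ‖z - w‖) := by gcongr
    _ = _ := by ring

theorem norm_RSX_half {κ : ℕ} (hκ : 0 < κ) (v : ℝ) : ‖RSX κ (1 / 2 + Complex.I * v)‖ = 1 := by
  have hk : (1 : ℝ) ≤ κ := by exact_mod_cast hκ
  have c1 : (κ : ℂ) - (1 / 2 + Complex.I * v)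
      = (starRingEnd ℂ) (1 / 2 + Complex.I * v + (κ : ℂ) - 1) := by
    apply Complex.ext
    · simp; ring
    · simp
  have c2 : 1 - (1 / 2 + Complex.I * v) = (starRingEnd ℂ) (1 / 2 + Complex.I * v) := by
    apply Complex.ext
    · simp; ring
    · simp
  have n1 : Complex.Gamma (1 / 2 + Complex.I * v + (κ : ℂ) - 1) ≠ 0 :=
    Complex.Gamma_ne_zero_of_re_pos (by simp; linarith)
  have n2 : Complex.Gamma (1 / 2 + Complex.I * v) ≠ 0 :=
    Complex.Gamma_ne_zero_of_re_pos (by simp)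
  have e : (2 * (Real.pi : ℂ)) = ((2 * Real.pi : ℝ) : ℂ) := by push_cast; rfl
  rw [RSX, c1, c2, Complex.Gamma_conj, Complex.Gamma_conj, norm_div, norm_mul, norm_mul, norm_mul,
    Complex.norm_conj, Complex.norm_conj, e, Complex.norm_cpow_eq_rpow_re_of_pos (by positivity)]
  have : (4 * (1 / 2 + Complex.I * (v : ℂ)) - 2).re = 0 := by simp; norm_num
  rw [this, Real.rpow_zero, one_mul, div_self]
  exact mul_ne_zero (norm_ne_zero_iff.2 n1) (norm_ne_zero_iff.2 n2)

theorem RSXLogDeriv_half_add_RSlogTau {κ : ℕ} (hκ : 0 < κ) {t : ℝ} (ht : t ≠ 0) :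
    RSXLogDeriv κ (1 / 2 + Complex.I * t) + (RSlogTau κ t : ℂ) = 0 := by
  have hk : (1 : ℝ) ≤ κ := by exact_mod_cast hκ
  have him : (1 / 2 + Complex.I * (t : ℂ)).im ≠ 0 := by simpa using ht
  have hne : RSX κ (1 / 2 + Complex.I * t) ≠ 0 := by
    rw [← norm_ne_zero_iff, norm_RSX_half hκ]; exact one_ne_zero
  have c1 : (κ : ℂ) - (1 / 2 + Complex.I * t)
      = (starRingEnd ℂ) (1 / 2 + Complex.I * t + (κ : ℂ) - 1) := by
    apply Complex.ext
    · simp; ring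
    · simp
  have c2 : 1 - (1 / 2 + Complex.I * t) = (starRingEnd ℂ) (1 / 2 + Complex.I * t) := by
    apply Complex.ext
    · simp; ring
    · simp
  have hreal : (RSXLogDeriv κ (1 / 2 + Complex.I * t)).im = 0 := by
    rw [RSXLogDeriv, c1, c2, digamma_conj, digamma_conj]
    · simp
    · simp
    · intro h; rw [h] at him; simp at him
    · simp; linarith
    · intro h
      have := congrArg Complex.im h
      simp [ht] at this
  rw [RSlogTau, (hasDerivAt_RSX κ him).deriv, mul_div_cancel_left₀ _ hne]
  apply Complex.ext
  · simp
  · rw [Complex.add_im, hreal, Complex.ofReal_im, Complex.zero_im, add_zero]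

theorem four_mul_log_sub_le_RSlogTau {κ : ℕ} (hκ : 0 < κ) {t : ℝ} (ht : 1 ≤ t) :
    4 * Real.log t - (12 + 4 * Real.log (2 * Real.pi)) ≤ RSlogTau κ t := by
  have hk : (1 : ℝ) ≤ κ := by exact_mod_cast hκ
  have h := congrArg Complex.re (RSXLogDeriv_half_add_RSlogTau hκ (t := t) (by linarith))
  have habs : t ≤ |t| := le_abs_self t
  have b1 := log_sub_three_le_re_digamma (z := κ - (1 / 2 + Complex.I * t)) ht
    (by simp; linarith) (by simpa using habs)
  have b2 := log_sub_three_le_re_digamma (z := 1 - (1 / 2 + Complex.I * t)) ht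
    (by simp; norm_num) (by simpa using habs)
  have b3 := log_sub_three_le_re_digamma (z := 1 / 2 + Complex.I * t + κ - 1) ht
    (by simp; linarith) (by simpa using habs)
  have b4 := log_sub_three_le_re_digamma (z := 1 / 2 + Complex.I * t) ht
    (by simp) (by simpa using habs)
  have e4 : (4 * (Real.log (2 * Real.pi) : ℂ)).re = 4 * Real.log (2 * Real.pi) := by
    simp only [Complex.mul_re, Complex.re_ofNat, Complex.im_ofNat, Complex.ofReal_re, zero_mul,
      sub_zero]
  rw [RSXLogDeriv, Complex.add_re, Complex.sub_re, Complex.add_re, Complex.add_re, Complex.add_re,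
    e4, Complex.ofReal_re, Complex.zero_re] at h
  linarith

theorem hasDerivAt_exp_mul_RSX (κ : ℕ) (ℓ s : ℂ) {z : ℂ} (hz : z.im ≠ 0) :
    HasDerivAt (fun z => Complex.exp ((z - s) * ℓ) * RSX κ z)
      (Complex.exp ((z - s) * ℓ) * RSX κ z * (RSXLogDeriv κ z + ℓ)) z := by
  have := ((((hasDerivAt_id z).sub_const s).mul_const ℓ).cexp).mul (hasDerivAt_RSX κ hz)
  refine this.congr_deriv ?_
  simp only [id]
  ring

theorem norm_exp_mul_RSX_sub_le {κ : ℕ} (hκ : 0 < κ) {a b : ℂ} {t T D : ℝ} (hT : 1 ≤ T)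
    (hTt : T ≤ t) (ha0 : 0 ≤ a.re) (ha1 : a.re ≤ 1) (hb0 : 0 ≤ b.re) (hb1 : b.re ≤ 1)
    (hai : T ≤ a.im) (hbi : T ≤ b.im)
    (haD : ‖a - (1 / 2 + Complex.I * t)‖ ≤ D) (hbD : ‖b - (1 / 2 + Complex.I * t)‖ ≤ D) :
    ‖Complex.exp ((b - a) * (RSlogTau κ t : ℂ)) * RSX κ b - RSX κ a‖
      ≤ ‖RSX κ a‖ * (Real.exp (16 / T * D * ‖b - a‖) - 1) := by
  have hseg : ∀ z ∈ segment ℝ a b, 0 ≤ z.re ∧ z.re ≤ 1 ∧ T ≤ z.im ∧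
      ‖z - (1 / 2 + Complex.I * t)‖ ≤ D := by
    intro z hz
    refine ⟨?_, ?_, ?_, ?_⟩
    · exact (convex_halfSpace_re_ge 0).segment_subset ha0 hb0 hz
    · exact (convex_halfSpace_re_le 1).segment_subset ha1 hb1 hz
    · exact (convex_halfSpace_im_ge T).segment_subset hai hbi hz
    · have := (convex_closedBall (1 / 2 + Complex.I * (t : ℂ)) D).segment_subset
        (mem_closedBall_iff_norm.2 haD) (mem_closedBall_iff_norm.2 hbD) hz
      exact mem_closedBall_iff_norm.1 this
  have key := norm_sub_le_of_hasDerivAt_mul (a := a) (b := b) (G := 16 / T * D)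
    (fun z hz => hasDerivAt_exp_mul_RSX κ (RSlogTau κ t : ℂ) a (z := z) (by
      have := (hseg z hz).2.2.1; linarith))
    (fun z hz => by
      obtain ⟨h0, h1, h2, h3⟩ := hseg z hz
      have e : RSXLogDeriv κ z + (RSlogTau κ t : ℂ)
          = RSXLogDeriv κ z - RSXLogDeriv κ (1 / 2 + Complex.I * t) := by
        linear_combination RSXLogDeriv_half_add_RSlogTau hκ (t := t) (by linarith)
      rw [e]
      refine (norm_RSXLogDeriv_sub_le hκ hT h0 h1 (by simp) (by simp; norm_num)
        (h2.trans (le_abs_self _)) (by simpa using hTt.trans (le_abs_self _))).trans ?_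
      gcongr)
  simpa using key

theorem exp_mul_RSlogTau_le_rpow {κ : ℕ} (hκ : 0 < κ) {σ t : ℝ} (h1 : 1 / 2 ≤ σ) (h2 : σ ≤ 1)
    (ht : 1 ≤ t) : Real.exp ((1 / 2 - σ) * RSlogTau κ t)
      ≤ Real.exp (6 + 2 * Real.log (2 * Real.pi)) * t ^ (2 - 4 * σ) := by
  rw [Real.rpow_def_of_pos (by linarith), ← Real.exp_add, Real.exp_le_exp]
  have hlog : 0 ≤ Real.log (2 * Real.pi) := Real.log_nonneg (by linarith [Real.pi_gt_three])
  have := mul_le_mul_of_nonneg_left (four_mul_log_sub_le_RSlogTau hκ ht) (sub_nonneg.2 h1)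
  nlinarith [mul_nonneg (sub_nonneg.2 h2) hlog]

theorem norm_RSX_le {κ : ℕ} (hκ : 0 < κ) {σ t : ℝ} (h1 : 1 / 2 ≤ σ) (h2 : σ ≤ 1)
    (ht : 2 ≤ t) : ‖RSX κ ((σ : ℂ) + Complex.I * t)‖
      ≤ Real.exp 2 * Real.exp ((1 / 2 - σ) * RSlogTau κ t) := by
  set s : ℂ := (σ : ℂ) + Complex.I * t
  set z : ℂ := 1 / 2 + Complex.I * t
  have hsz : s - z = ((σ - 1 / 2 : ℝ) : ℂ) := by simp [s, z]
  have hn : ‖s - z‖ ≤ 1 / 2 := by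
    rw [hsz, Complex.norm_real, Real.norm_eq_abs, abs_of_nonneg (by linarith)]; linarith
  have key := norm_exp_mul_RSX_sub_le hκ (a := z) (b := s) (t := t) (T := t) (D := 1 / 2)
    (by linarith) le_rfl (by simp [z]) (by simp [z]; norm_num) (by simp [s]; linarith)
    (by simpa [s] using h2) (by simp [z]) (by simp [s]) (by simp [z]) hn
  rw [show RSX κ z = RSX κ (1 / 2 + Complex.I * t) from rfl, norm_RSX_half hκ, one_mul] at key
  have h3 : 16 / t * (1 / 2) * ‖s - z‖ ≤ 2 := by
    calc 16 / t * (1 / 2) * ‖s - z‖ ≤ 16 / 2 * (1 / 2) * (1 / 2) := by gcongr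
      _ = 2 := by norm_num
  have h4 : ‖Complex.exp ((s - z) * (RSlogTau κ t : ℂ)) * RSX κ s‖ ≤ Real.exp 2 := by
    have := norm_sub_norm_le (Complex.exp ((s - z) * (RSlogTau κ t : ℂ)) * RSX κ s)
      (RSX κ (1 / 2 + Complex.I * t))
    rw [norm_RSX_half hκ] at this
    have := Real.exp_le_exp.2 h3
    linarith
  rw [norm_mul, hsz, ← Complex.ofReal_mul, Complex.norm_exp_ofReal] at h4
  have h5 : Real.exp ((σ - 1 / 2) * RSlogTau κ t) * Real.exp ((1 / 2 - σ) * RSlogTau κ t) = 1 := by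
    rw [← Real.exp_add]; ring_nf; exact Real.exp_zero
  calc ‖RSX κ s‖ = (Real.exp ((σ - 1 / 2) * RSlogTau κ t) * ‖RSX κ s‖)
        * Real.exp ((1 / 2 - σ) * RSlogTau κ t) := by linear_combination -‖RSX κ s‖ * h5
    _ ≤ _ := by gcongr

/-- Lemma 3, part 3 (eq. (3.7)): on the line `Re w = 1/2`,
`Φ(w; s, τ(t)) ≪ t^{2-4σ} min(1, |w-s|²/t)`. -/
theorem rankin_selberg_Phi_bound (κ : ℕ) (hκ : 0 < κ) :
    ∃ C : ℝ, ∀ σ t v : ℝ, 1 / 2 ≤ σ → σ ≤ 1 → 3 ≤ t →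
      ‖RSPhi κ (1 / 2 + Complex.I * v) ((σ : ℂ) + Complex.I * t) t‖
        ≤ C * t ^ (2 - 4 * σ) *
            min 1 (‖(1 / 2 + Complex.I * v) - ((σ : ℂ) + Complex.I * t)‖ ^ 2 / t) := by
  refine ⟨Real.exp 2 * Real.exp (6 + 2 * Real.log (2 * Real.pi)) * (80 * Real.exp 80), ?_⟩
  intro σ t v h1 h2 ht
  have hM := exp_mul_RSlogTau_le_rpow hκ h1 h2 (t := t) (by linarith)
  have hX := norm_RSX_le hκ h1 h2 (t := t) (by linarith)
  have hw := norm_RSX_half hκ v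
  set s : ℂ := (σ : ℂ) + Complex.I * t
  set w : ℂ := 1 / 2 + Complex.I * v
  set M := Real.exp ((1 / 2 - σ) * RSlogTau κ t)
  set B := Real.exp (6 + 2 * Real.log (2 * Real.pi)) * t ^ (2 - 4 * σ)
  have hMB : Real.exp 2 * M * (80 * Real.exp 80)
      ≤ Real.exp 2 * Real.exp (6 + 2 * Real.log (2 * Real.pi)) * (80 * Real.exp 80) * t ^ (2 - 4 * σ) := by
    calc Real.exp 2 * M * (80 * Real.exp 80) ≤ Real.exp 2 * B * (80 * Real.exp 80) := by gcongr
      _ = _ := by ring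
  have hM0 : 0 < M := Real.exp_pos _
  have hre : |1 / 2 - σ| ≤ ‖w - s‖ := by
    simpa [s, w] using Complex.abs_re_le_norm (w - s)
  have him : |v - t| ≤ ‖w - s‖ := by
    simpa [s, w] using Complex.abs_im_le_norm (w - s)
  rw [RSPhi]
  suffices h : ‖Complex.exp ((w - s) * (RSlogTau κ t : ℂ)) * RSX κ w - RSX κ s‖
      ≤ Real.exp 2 * M * (80 * Real.exp 80) * min 1 (‖w - s‖ ^ 2 / t) from
    h.trans (mul_le_mul_of_nonneg_right hMB (by positivity))
  rcases le_total (‖w - s‖ ^ 2) t with hle | hge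
  · rw [min_eq_right (div_le_one_of_le₀ hle (by linarith))]
    have hv : 2 / 5 * t ≤ v := by
      have : (v - t) ^ 2 ≤ t := by
        rw [← sq_abs]; exact (by gcongr : |v - t| ^ 2 ≤ ‖w - s‖ ^ 2).trans hle
      nlinarith
    have hsD : ‖s - (1 / 2 + Complex.I * t)‖ ≤ ‖w - s‖ := by
      have e : s - (1 / 2 + Complex.I * t) = ((σ - 1 / 2 : ℝ) : ℂ) := by simp [s]
      rw [e, Complex.norm_real, Real.norm_eq_abs, abs_sub_comm]
      exact hre
    have hwD : ‖w - (1 / 2 + Complex.I * t)‖ ≤ ‖w - s‖ := by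
      have e : w - (1 / 2 + Complex.I * t) = Complex.I * ((v - t : ℝ) : ℂ) := by
        simp [w]; ring
      rw [e, norm_mul, Complex.norm_I, one_mul, Complex.norm_real, Real.norm_eq_abs]
      exact him
    have key := norm_exp_mul_RSX_sub_le hκ (a := s) (b := w) (t := t) (T := 2 / 5 * t)
      (D := ‖w - s‖) (by linarith) (by linarith) (by simp [s]; linarith) (by simpa [s] using h2)
      (by simp [w]) (by simp [w]; norm_num) (by simp [s]; linarith) (by simpa [w] using hv) hsD hwD
    set ε := ‖w - s‖ ^ 2 / t with hε
    have hε0 : 0 ≤ ε := by positivity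
    have hε1 : ε ≤ 1 := div_le_one_of_le₀ hle (by linarith)
    have e1 : 16 / (2 / 5 * t) * ‖w - s‖ * ‖w - s‖ = 40 * ε := by
      rw [hε]; field_simp; ring
    rw [e1] at key
    have h6 : Real.exp (40 * ε) - 1 ≤ 80 * Real.exp 80 * ε := by
      have a1 := Real.one_sub_le_exp_neg (40 * ε)
      have a2 : Real.exp (40 * ε) * Real.exp (-(40 * ε)) = 1 := by
        rw [← Real.exp_add]; simp
      have a3 : Real.exp (40 * ε) ≤ Real.exp 80 := Real.exp_le_exp.2 (by linarith)
      have a4 := Real.exp_pos (40 * ε)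
      nlinarith [mul_le_mul_of_nonneg_left a1 a4.le, mul_le_mul_of_nonneg_right a3 hε0,
        mul_nonneg a4.le hε0]
    calc _ ≤ _ := key
      _ ≤ (Real.exp 2 * M) * (80 * Real.exp 80 * ε) := by
        gcongr
        linarith [Real.add_one_le_exp (40 * ε)]
      _ = _ := by ring
  · rw [min_eq_left ((one_le_div (by linarith)).2 hge), mul_one]
    refine (norm_sub_le _ _).trans ?_
    rw [norm_mul, hw, mul_one, Complex.norm_exp]
    have : ((w - s) * (RSlogTau κ t : ℂ)).re = (1 / 2 - σ) * RSlogTau κ t := by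
      rw [Complex.re_mul_ofReal]; simp [w, s]
    rw [this]
    have a1 : 1 ≤ Real.exp 2 := Real.one_le_exp (by norm_num)
    have a2 : 1 ≤ Real.exp 80 := Real.one_le_exp (by norm_num)
    have a3 : 2 ≤ 80 * Real.exp 80 := by linarith
    calc M + ‖RSX κ s‖ ≤ M + Real.exp 2 * M := by gcongr
      _ ≤ Real.exp 2 * M * 2 := by nlinarith
      _ ≤ _ := by gcongr
end

section
/- Second derivative of log X on the critical line (intermediate claim in the proof of Lemma 3). Let κ be a positive integer. There are constants c₁, c₂ > 0 (depending only on κ) such that for all v ≥ 3: c₁/v ≤ |(X′/X)′(1/2+iv)| ≤ c₂/v, where (X′/X)′ denotes the complex derivative of the logarithmic derivative X′/X of X. -/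
open Complex

open Filter Topology

/-- The `j`-th term of the Weierstrass series for `log Γ(s + 1)`. -/
noncomputable def logGammaTerm (j : ℕ) (s : ℂ) : ℂ :=
  s * (Real.log (j + 2) - Real.log (j + 1) : ℝ) -
    (Complex.log (s + (j + 1)) - (Real.log (j + 1) : ℝ))

lemma natCast_add_one_le_norm_add {s : ℂ} (hs : 0 ≤ s.re) (j : ℕ) :
    (j + 1 : ℝ) ≤ ‖s + (j + 1)‖ := by
  refine le_trans ?_ (Complex.re_le_norm _)
  simp [hs]

lemma add_natCast_add_one_ne_zero {s : ℂ} (hs : 0 ≤ s.re) (j : ℕ) : s + (j + 1) ≠ 0 := by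
  rw [← norm_pos_iff]
  exact lt_of_lt_of_le (by positivity) (natCast_add_one_le_norm_add hs j)

lemma hasDerivAt_logGammaTerm {s : ℂ} (hs : 0 ≤ s.re) (j : ℕ) :
    HasDerivAt (logGammaTerm j)
      ((Real.log (j + 2) - Real.log (j + 1) : ℝ) - (s + (j + 1))⁻¹) s := by
  have hslit : s + ((j : ℂ) + 1) ∈ Complex.slitPlane := by
    left
    simp only [Complex.add_re, Complex.natCast_re, Complex.one_re]
    positivity
  have h1 := (hasDerivAt_id s).mul_const ((Real.log (j + 2) - Real.log (j + 1) : ℝ) : ℂ)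
  have h2 := (((hasDerivAt_id s).add_const ((j : ℂ) + 1)).clog hslit).sub_const
    ((Real.log (j + 1) : ℝ) : ℂ)
  exact (h1.sub h2).congr_deriv (by simp)

lemma hasDerivAt_sub_inv_add {s : ℂ} (hs : 0 ≤ s.re) (c : ℂ) (j : ℕ) :
    HasDerivAt (fun z : ℂ => c - (z + (j + 1))⁻¹) (((s + (j + 1)) ^ 2)⁻¹) s := by
  have h := (((hasDerivAt_id s).add_const ((j : ℂ) + 1)).inv
    (add_natCast_add_one_ne_zero hs j)).const_sub c
  refine h.congr_deriv ?_
  simp [neg_div]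

lemma abs_log_sub_log_sub_inv_le (j : ℕ) :
    |Real.log (j + 2) - Real.log (j + 1) - ((j : ℝ) + 1)⁻¹| ≤ (((j : ℝ) + 1) ^ 2)⁻¹ := by
  have hj : (0 : ℝ) < j + 1 := by positivity
  have hj2 : (0 : ℝ) < j + 2 := by positivity
  rw [← Real.log_div hj2.ne' hj.ne']
  have h1 := Real.log_le_sub_one_of_pos (div_pos hj2 hj)
  have h2 := Real.one_sub_inv_le_log_of_pos (div_pos hj2 hj)
  have e1 : ((j : ℝ) + 2) / (j + 1) - 1 = ((j : ℝ) + 1)⁻¹ := by field_simp; ring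
  have e2 : 1 - (((j : ℝ) + 2) / (j + 1))⁻¹ = ((j : ℝ) + 2)⁻¹ := by field_simp; ring
  have e3 : ((j : ℝ) + 1)⁻¹ - ((j : ℝ) + 2)⁻¹ ≤ (((j : ℝ) + 1) ^ 2)⁻¹ := by
    rw [inv_sub_inv hj.ne' hj2.ne', inv_eq_one_div, div_le_div_iff₀ (by positivity) (by positivity)]
    nlinarith
  rw [e1] at h1
  rw [e2] at h2
  have : (0 : ℝ) ≤ (((j : ℝ) + 1) ^ 2)⁻¹ := by positivity
  rw [abs_le]
  constructor <;> linarith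

lemma norm_deriv_logGammaTerm_le {s : ℂ} (hs : 0 ≤ s.re) {R : ℝ} (hR : ‖s‖ ≤ R) (j : ℕ) :
    ‖((Real.log (j + 2) - Real.log (j + 1) : ℝ) : ℂ) - (s + (j + 1))⁻¹‖ ≤
      (1 + R) * (((j : ℝ) + 1) ^ 2)⁻¹ := by
  have hj : (0 : ℝ) < j + 1 := by positivity
  have hjc : ((j : ℂ) + 1) ≠ 0 := Nat.cast_add_one_ne_zero j
  have hne := add_natCast_add_one_ne_zero hs j
  have hnorm : ‖(j : ℂ) + 1‖ = j + 1 := by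
    rw [← Nat.cast_add_one, Complex.norm_natCast, Nat.cast_add_one]
  have e : ((Real.log (j + 2) - Real.log (j + 1) : ℝ) : ℂ) - (s + (j + 1))⁻¹ =
      ((Real.log (j + 2) - Real.log (j + 1) - ((j : ℝ) + 1)⁻¹ : ℝ) : ℂ) +
        s / ((j + 1) * (s + (j + 1))) := by
    push_cast
    field_simp
    ring
  rw [e]
  refine (norm_add_le _ _).trans ?_
  rw [add_mul 1 R, one_mul (((j : ℝ) + 1) ^ 2)⁻¹]
  refine add_le_add ?_ ?_
  · rw [Complex.norm_real]
    exact abs_log_sub_log_sub_inv_le j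
  · rw [norm_div, norm_mul, hnorm, ← div_eq_mul_inv, sq]
    have := natCast_add_one_le_norm_add hs j
    have hR0 : 0 ≤ R := (norm_nonneg s).trans hR
    gcongr

lemma logGammaTerm_zero (j : ℕ) : logGammaTerm j 0 = 0 := by
  have : Complex.log ((j : ℂ) + 1) = (Real.log (j + 1) : ℝ) := by
    rw [Complex.ofReal_log (by positivity)]
    push_cast
    rfl
  simp [logGammaTerm, this]

lemma norm_logGammaTerm_le {s : ℂ} (hs : 0 ≤ s.re) {R : ℝ} (hR : ‖s‖ ≤ R) (j : ℕ) :
    ‖logGammaTerm j s‖ ≤ (1 + R) * R * (((j : ℝ) + 1) ^ 2)⁻¹ := by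
  have hR0 : 0 ≤ R := (norm_nonneg s).trans hR
  have hconv : Convex ℝ ({z : ℂ | 0 ≤ z.re} ∩ Metric.closedBall 0 R) :=
    (convex_halfSpace_re_ge 0).inter (convex_closedBall 0 R)
  have h := hconv.norm_image_sub_le_of_norm_hasDerivWithin_le (f := logGammaTerm j)
    (C := (1 + R) * (((j : ℝ) + 1) ^ 2)⁻¹) (x := 0) (y := s)
    (fun z hz => (hasDerivAt_logGammaTerm hz.1 j).hasDerivWithinAt)
    (fun z hz => norm_deriv_logGammaTerm_le hz.1 (by simpa using hz.2) j)
    (by simp [hR0]) (by simp [hs, hR])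
  rw [logGammaTerm_zero, sub_zero, sub_zero] at h
  refine h.trans ?_
  have : 0 ≤ (1 + R) * (((j : ℝ) + 1) ^ 2)⁻¹ := by positivity
  calc _ ≤ (1 + R) * (((j : ℝ) + 1) ^ 2)⁻¹ * R := by gcongr
    _ = _ := by ring

lemma summable_inv_natCast_add_one_sq : Summable fun j : ℕ => (((j : ℝ) + 1) ^ 2)⁻¹ := by
  have := (summable_nat_add_iff 1).mpr (Real.summable_nat_pow_inv.mpr (one_lt_two))
  simpa using this

lemma isOpen_re_pos_inter_ball (R : ℝ) : IsOpen ({z : ℂ | 0 < z.re} ∩ Metric.ball 0 R) :=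
  (isOpen_lt continuous_const Complex.continuous_re).inter Metric.isOpen_ball

lemma summable_logGammaTerm {s : ℂ} (hs : 0 ≤ s.re) : Summable fun j => logGammaTerm j s :=
  Summable.of_norm_bounded (summable_inv_natCast_add_one_sq.mul_left _)
    (norm_logGammaTerm_le hs le_rfl)

lemma hasDerivAt_tsum_logGammaTerm {s : ℂ} (hs : 0 < s.re) :
    HasDerivAt (fun z => ∑' j, logGammaTerm j z)
      (∑' j : ℕ, (((Real.log (j + 2) - Real.log (j + 1) : ℝ) : ℂ) - (s + (j + 1))⁻¹)) s := by
  set U := {z : ℂ | 0 < z.re} ∩ Metric.ball 0 (‖s‖ + 1)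
  have hU : IsOpen U := isOpen_re_pos_inter_ball _
  have hsU : s ∈ U := ⟨hs, by simp⟩
  have hu := summable_inv_natCast_add_one_sq.mul_left ((1 + (‖s‖ + 1)) * (‖s‖ + 1))
  have hdiff : ∀ j, DifferentiableOn ℂ (logGammaTerm j) U := fun j z hz =>
    (hasDerivAt_logGammaTerm (le_of_lt hz.1) j).differentiableAt.differentiableWithinAt
  have hle : ∀ (j : ℕ) (z : ℂ), z ∈ U → ‖logGammaTerm j z‖ ≤
      (1 + (‖s‖ + 1)) * (‖s‖ + 1) * (((j : ℝ) + 1) ^ 2)⁻¹ := fun j z hz =>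
    norm_logGammaTerm_le (le_of_lt hz.1) (by simpa using (Metric.mem_ball.mp hz.2).le) j
  have h := Complex.hasSum_deriv_of_summable_norm hu hdiff hU hle hsU
  have hd := (Complex.differentiableOn_tsum_of_summable_norm hu hdiff hU hle).differentiableAt
    (hU.mem_nhds hsU)
  refine hd.hasDerivAt.congr_deriv ?_
  rw [← h.tsum_eq]
  exact tsum_congr fun j => (hasDerivAt_logGammaTerm hs.le j).deriv

lemma hasDerivAt_tsum_sub_inv_add {s : ℂ} (hs : 0 < s.re) :
    HasDerivAt (fun z : ℂ =>
        ∑' j : ℕ, (((Real.log (j + 2) - Real.log (j + 1) : ℝ) : ℂ) - (z + (j + 1))⁻¹))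
      (∑' j : ℕ, ((s + (j + 1)) ^ 2)⁻¹) s := by
  set U := {z : ℂ | 0 < z.re} ∩ Metric.ball 0 (‖s‖ + 1)
  have hU : IsOpen U := isOpen_re_pos_inter_ball _
  have hsU : s ∈ U := ⟨hs, by simp⟩
  have hu := summable_inv_natCast_add_one_sq.mul_left (1 + (‖s‖ + 1))
  have hdiff : ∀ j : ℕ, DifferentiableOn ℂ (fun z : ℂ =>
      ((Real.log (j + 2) - Real.log (j + 1) : ℝ) : ℂ) - (z + (j + 1))⁻¹) U := fun j z hz =>
    (hasDerivAt_sub_inv_add (le_of_lt hz.1) _ j).differentiableAt.differentiableWithinAt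
  have hle : ∀ (j : ℕ) (z : ℂ), z ∈ U →
      ‖((Real.log (j + 2) - Real.log (j + 1) : ℝ) : ℂ) - (z + (j + 1))⁻¹‖ ≤
      (1 + (‖s‖ + 1)) * (((j : ℝ) + 1) ^ 2)⁻¹ := fun j z hz =>
    norm_deriv_logGammaTerm_le (le_of_lt hz.1) (by simpa using (Metric.mem_ball.mp hz.2).le) j
  have h := Complex.hasSum_deriv_of_summable_norm hu hdiff hU hle hsU
  have hd := (Complex.differentiableOn_tsum_of_summable_norm hu hdiff hU hle).differentiableAt
    (hU.mem_nhds hsU)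
  refine hd.hasDerivAt.congr_deriv ?_
  rw [← h.tsum_eq]
  exact tsum_congr fun j => (hasDerivAt_sub_inv_add hs.le _ j).deriv

lemma exp_sum_logGammaTerm {s : ℂ} (hs : 0 < s.re) (n : ℕ) :
    Complex.exp (∑ j ∈ Finset.range n, logGammaTerm j s) =
      ((n + 1 : ℕ) : ℂ) ^ s * n.factorial / ∏ j ∈ Finset.range n, (s + (j + 1)) := by
  induction n with
  | zero => simp
  | succ n ih =>
    have hlog : ∀ m : ℕ, ((Real.log ((m : ℝ) + 1) : ℝ) : ℂ) = Complex.log ((m + 1 : ℕ) : ℂ) := by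
      intro m
      rw [Complex.ofReal_log (by positivity)]
      push_cast
      rfl
    have h2 : ((n : ℝ) + 2) = ((n + 1 : ℕ) : ℝ) + 1 := by push_cast; ring
    have hn : ((n + 1 : ℕ) : ℂ) ≠ 0 := Nat.cast_ne_zero.mpr (by lia)
    have hn' : ((n + 1 + 1 : ℕ) : ℂ) ≠ 0 := Nat.cast_ne_zero.mpr (by lia)
    have hne := add_natCast_add_one_ne_zero hs.le n
    rw [Finset.sum_range_succ, Complex.exp_add, ih, Finset.prod_range_succ, logGammaTerm,
      Complex.ofReal_sub, h2, hlog, hlog, Complex.exp_sub, Complex.exp_sub,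
      Complex.exp_log hn, Complex.exp_log hne, mul_sub, Complex.exp_sub,
      Complex.cpow_def_of_ne_zero hn, Complex.cpow_def_of_ne_zero hn', Nat.factorial_succ,
      mul_comm s, mul_comm s]
    have hprod : ∏ j ∈ Finset.range n, (s + ((j : ℂ) + 1)) ≠ 0 :=
      Finset.prod_ne_zero_iff.mpr fun j _ => add_natCast_add_one_ne_zero hs.le j
    have hexp := Complex.exp_ne_zero (Complex.log ((n + 1 : ℕ) : ℂ) * s)
    rw [Nat.cast_mul]
    field_simp

lemma exp_tsum_logGammaTerm {s : ℂ} (hs : 0 < s.re) :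
    Complex.exp (∑' j, logGammaTerm j s) = s * Complex.Gamma s := by
  have hs0 : s ≠ 0 := by
    rintro rfl
    simp at hs
  have h1 : Tendsto (fun n => Complex.exp (∑ j ∈ Finset.range n, logGammaTerm j s)) atTop
      (𝓝 (Complex.exp (∑' j, logGammaTerm j s))) :=
    (Complex.continuous_exp.tendsto _).comp (summable_logGammaTerm hs.le).hasSum.tendsto_sum_nat
  have h2 : Tendsto (fun n : ℕ => ((n + 1 : ℕ) : ℂ) / ((n + 1 : ℕ) + s)) atTop (𝓝 1) :=
    (tendsto_natCast_div_add_atTop s).comp (tendsto_add_atTop_nat 1)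
  have h3 : Tendsto (fun n : ℕ => s * Complex.GammaSeq s (n + 1)) atTop
      (𝓝 (s * Complex.Gamma s)) :=
    ((Complex.GammaSeq_tendsto_Gamma s).comp (tendsto_add_atTop_nat 1)).const_mul s
  have h4 := h1.mul h2
  rw [mul_one] at h4
  refine tendsto_nhds_unique h4 (h3.congr fun n => ?_)
  have hprod : ∏ j ∈ Finset.range n, (s + ((j : ℂ) + 1)) ≠ 0 :=
    Finset.prod_ne_zero_iff.mpr fun j _ => add_natCast_add_one_ne_zero hs.le j
  have hne := add_natCast_add_one_ne_zero hs.le n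
  have hne' : (n : ℂ) + 1 + s ≠ 0 := by rwa [add_comm]
  rw [exp_sum_logGammaTerm hs, Complex.GammaSeq, Finset.prod_range_succ', Finset.prod_range_succ,
    Nat.factorial_succ]
  push_cast
  rw [add_zero, add_comm s ((n : ℂ) + 1)]
  field_simp

lemma digamma_eq_tsum_sub_inv {s : ℂ} (hs : 0 < s.re) :
    Complex.digamma s =
      (∑' j : ℕ, (((Real.log (j + 2) - Real.log (j + 1) : ℝ) : ℂ) - (s + (j + 1))⁻¹)) - s⁻¹ := by
  have hopen : {z : ℂ | 0 < z.re} ∈ 𝓝 s :=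
    (isOpen_lt continuous_const Complex.continuous_re).mem_nhds hs
  have hs0 : s ≠ 0 := by
    rintro rfl
    simp at hs
  have hev : Complex.Gamma =ᶠ[𝓝 s] fun z => Complex.exp (∑' j, logGammaTerm j z) / z := by
    filter_upwards [hopen] with z hz
    have hz0 : z ≠ 0 := by
      rintro rfl
      simp at hz
    rw [exp_tsum_logGammaTerm hz]
    field_simp
  have hd := ((hasDerivAt_tsum_logGammaTerm hs).cexp).div (hasDerivAt_id s) hs0
  rw [Complex.digamma_def, logDeriv_apply, hev.deriv_eq, hev.eq_of_nhds]
  have := Complex.exp_ne_zero (∑' j, logGammaTerm j s)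
  erw [hd.deriv]
  simp only [id]
  field_simp

lemma summable_inv_add_natCast_sq {s : ℂ} (hs : 0 < s.re) :
    Summable fun n : ℕ => ((s + n) ^ 2)⁻¹ := by
  rw [← summable_nat_add_iff 1]
  refine Summable.of_norm_bounded summable_inv_natCast_add_one_sq fun j => ?_
  have := natCast_add_one_le_norm_add hs.le j
  rw [norm_inv, norm_pow, Nat.cast_add_one]
  gcongr

/-- The series of the trigamma function on the right half-plane. -/
theorem hasDerivAt_digamma {s : ℂ} (hs : 0 < s.re) :
    HasDerivAt Complex.digamma (∑' n : ℕ, ((s + n) ^ 2)⁻¹) s := by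
  have hopen : {z : ℂ | 0 < z.re} ∈ 𝓝 s :=
    (isOpen_lt continuous_const Complex.continuous_re).mem_nhds hs
  have hs0 : s ≠ 0 := by
    rintro rfl
    simp at hs
  have h := (hasDerivAt_tsum_sub_inv_add hs).sub (hasDerivAt_inv hs0)
  refine (h.congr_of_eventuallyEq ?_).congr_deriv ?_
  · filter_upwards [hopen] with z hz
    exact digamma_eq_tsum_sub_inv hz
  · rw [(summable_inv_add_natCast_sq hs).tsum_eq_zero_add]
    simp [add_comm]

lemma im_inv_add_mul_I_sq (a v : ℝ) :
    (((a + Complex.I * v : ℂ) ^ 2)⁻¹).im = -(2 * v * (a / (a ^ 2 + v ^ 2) ^ 2)) := by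
  have : Complex.normSq ((a + Complex.I * v : ℂ) ^ 2) = (a ^ 2 + v ^ 2) ^ 2 := by
    rw [map_pow, mul_comm, Complex.normSq_add_mul_I]
  rw [Complex.inv_im, this]
  simp [sq]
  ring

lemma hasSum_telescoping (m : ℕ) {v : ℝ} (hv : 0 < v) :
    HasSum (fun n : ℕ => 2 * (m + n + 1 / 2) /
      ((((m + n : ℝ)) ^ 2 + v ^ 2) * ((m + n + 1 : ℝ) ^ 2 + v ^ 2))) (1 / ((m : ℝ) ^ 2 + v ^ 2)) := by
  rw [hasSum_iff_tendsto_nat_of_nonneg (fun n => by positivity)]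
  have hterm : ∀ n : ℕ, 2 * (m + n + 1 / 2) /
      ((((m + n : ℝ)) ^ 2 + v ^ 2) * ((m + n + 1 : ℝ) ^ 2 + v ^ 2)) =
      1 / ((m + n : ℝ) ^ 2 + v ^ 2) - 1 / ((m + (n + 1 : ℕ) : ℝ) ^ 2 + v ^ 2) := by
    intro n
    push_cast
    have h1 : ((m + n : ℝ)) ^ 2 + v ^ 2 ≠ 0 := by positivity
    have h2 : (m + n + 1 : ℝ) ^ 2 + v ^ 2 ≠ 0 := by positivity
    rw [← add_assoc]
    field_simp
    ring
  have hlim : Tendsto (fun n : ℕ => 1 / ((m + n : ℝ) ^ 2 + v ^ 2)) atTop (𝓝 0) := by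
    refine tendsto_const_nhds.div_atTop ?_
    refine tendsto_atTop_add_const_right _ _ ?_
    exact (tendsto_pow_atTop two_ne_zero).comp
      (tendsto_atTop_add_const_left _ _ tendsto_natCast_atTop_atTop)
  have hsum : ∀ n : ℕ, ∑ i ∈ Finset.range n, 2 * (m + i + 1 / 2) /
      ((((m + i : ℝ)) ^ 2 + v ^ 2) * ((m + i + 1 : ℝ) ^ 2 + v ^ 2)) =
      1 / ((m : ℝ) ^ 2 + v ^ 2) - 1 / ((m + n : ℝ) ^ 2 + v ^ 2) := by
    intro n
    rw [Finset.sum_congr rfl fun i _ => hterm i,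
      Finset.sum_range_sub' (fun n : ℕ => 1 / ((m + n : ℝ) ^ 2 + v ^ 2))]
    simp
  simp_rw [hsum]
  simpa only [sub_zero] using hlim.const_sub (1 / ((m : ℝ) ^ 2 + v ^ 2))

lemma div_sq_le_telescoping {x v : ℝ} (hx : 0 ≤ x) (hv : 3 ≤ v) :
    (x + 1 / 2) / ((x + 1 / 2) ^ 2 + v ^ 2) ^ 2 ≤
      2 * (x + 1 / 2) / ((x ^ 2 + v ^ 2) * ((x + 1) ^ 2 + v ^ 2)) := by
  have hv2 : 9 ≤ v ^ 2 := by nlinarith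
  have key : (x ^ 2 + v ^ 2) * ((x + 1) ^ 2 + v ^ 2) ≤ 2 * ((x + 1 / 2) ^ 2 + v ^ 2) ^ 2 := by
    nlinarith [sq_nonneg ((x + 1 / 2) ^ 2), mul_nonneg (sq_nonneg (x + 1 / 2)) (sq_nonneg v)]
  rw [div_le_div_iff₀ (by positivity) (by positivity)]
  nlinarith [mul_le_mul_of_nonneg_left key (by positivity : 0 ≤ x + 1 / 2)]

lemma telescoping_le_div_sq {x v : ℝ} (hx : 0 ≤ x) (hv : 3 ≤ v) :
    1 / 4 * (2 * (x + 1 / 2) / ((x ^ 2 + v ^ 2) * ((x + 1) ^ 2 + v ^ 2))) ≤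
      (x + 1 / 2) / ((x + 1 / 2) ^ 2 + v ^ 2) ^ 2 := by
  have hv2 : 9 ≤ v ^ 2 := by nlinarith
  have key : ((x + 1 / 2) ^ 2 + v ^ 2) ^ 2 ≤ 2 * ((x ^ 2 + v ^ 2) * ((x + 1) ^ 2 + v ^ 2)) := by
    nlinarith [sq_nonneg ((x + 1 / 2) ^ 2), mul_nonneg (sq_nonneg (x + 1 / 2)) (sub_nonneg.2 hv2)]
  rw [← mul_div_assoc, div_le_div_iff₀ (by positivity) (by positivity)]
  nlinarith [mul_le_mul_of_nonneg_left key (by positivity : 0 ≤ x + 1 / 2)]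

lemma summable_div_sq (m : ℕ) {v : ℝ} (hv : 3 ≤ v) :
    Summable fun n : ℕ => (m + n + 1 / 2 : ℝ) / ((m + n + 1 / 2) ^ 2 + v ^ 2) ^ 2 :=
  Summable.of_nonneg_of_le (fun n => by positivity)
    (fun n => div_sq_le_telescoping (by positivity) hv)
    (hasSum_telescoping m (by linarith)).summable

lemma tsum_div_sq_le (m : ℕ) {v : ℝ} (hv : 3 ≤ v) :
    ∑' n : ℕ, (m + n + 1 / 2 : ℝ) / ((m + n + 1 / 2) ^ 2 + v ^ 2) ^ 2 ≤ 1 / v ^ 2 := by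
  have h := hasSum_telescoping m (v := v) (by linarith)
  calc _ ≤ 1 / ((m : ℝ) ^ 2 + v ^ 2) := by
        rw [← h.tsum_eq]
        exact (summable_div_sq m hv).tsum_le_tsum
          (fun n => div_sq_le_telescoping (by positivity) hv) h.summable
    _ ≤ _ := by
        gcongr
        nlinarith [sq_nonneg (m : ℝ)]

lemma le_tsum_div_sq {v : ℝ} (hv : 3 ≤ v) :
    1 / 4 * (1 / v ^ 2) ≤
      ∑' n : ℕ, ((0 : ℕ) + n + 1 / 2 : ℝ) / (((0 : ℕ) + n + 1 / 2) ^ 2 + v ^ 2) ^ 2 := by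
  have h := (hasSum_telescoping 0 (v := v) (by linarith)).mul_left (1 / 4)
  calc 1 / 4 * (1 / v ^ 2) = 1 / 4 * (1 / (((0 : ℕ) : ℝ) ^ 2 + v ^ 2)) := by simp
    _ ≤ _ := by
        rw [← h.tsum_eq]
        exact h.summable.tsum_le_tsum (fun n => telescoping_le_div_sq (by positivity) hv)
          (summable_div_sq 0 hv)

lemma im_tsum_inv_add_natCast_sq (m : ℕ) (v : ℝ) :
    (∑' n : ℕ, (((m + 1 / 2 + Complex.I * v : ℂ) + n) ^ 2)⁻¹).im =
      -(2 * v * ∑' n : ℕ, (m + n + 1 / 2 : ℝ) / ((m + n + 1 / 2) ^ 2 + v ^ 2) ^ 2) := by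
  have hre : 0 < (m + 1 / 2 + Complex.I * v : ℂ).re := by
    simp
    positivity
  rw [Complex.im_tsum (summable_inv_add_natCast_sq hre), ← tsum_mul_left, ← tsum_neg]
  refine tsum_congr fun n => ?_
  rw [← im_inv_add_mul_I_sq]
  congr 3
  push_cast
  ring

lemma tsum_inv_conj_add_natCast_sq (s : ℂ) :
    ∑' n : ℕ, (((starRingEnd ℂ) s + n) ^ 2)⁻¹ =
      (starRingEnd ℂ) (∑' n : ℕ, ((s + n) ^ 2)⁻¹) := by
  rw [Complex.conj_tsum]
  simp

lemma logDeriv_mul_mul_div_mul {p a b c d : ℂ → ℂ} {z : ℂ} (np : p z ≠ 0) (na : a z ≠ 0)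
    (nb : b z ≠ 0) (nc : c z ≠ 0) (nd : d z ≠ 0) (dp : DifferentiableAt ℂ p z)
    (da : DifferentiableAt ℂ a z) (db : DifferentiableAt ℂ b z) (dc : DifferentiableAt ℂ c z)
    (dd : DifferentiableAt ℂ d z) :
    logDeriv (fun w => p w * a w * b w / (c w * d w)) z =
      logDeriv p z + logDeriv a z + logDeriv b z - (logDeriv c z + logDeriv d z) := by
  rw [logDeriv_div (f := fun w => p w * a w * b w) (g := fun w => c w * d w) z
      (mul_ne_zero (mul_ne_zero np na) nb) (mul_ne_zero nc nd) ((dp.mul da).mul db) (dc.mul dd),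
    logDeriv_mul (f := fun w => p w * a w) z (mul_ne_zero np na) nb (dp.mul da) db,
    logDeriv_mul z np na dp da, logDeriv_mul z nc nd dc dd]

lemma logDeriv_RSX {κ : ℕ} (hκ : 0 < κ) {z : ℂ} (h0 : 0 < z.re) (h1 : z.re < 1) :
    logDeriv (RSX κ) z = 4 * Complex.log (2 * Real.pi) - Complex.digamma (κ - z) -
      Complex.digamma (1 - z) - (Complex.digamma (z + κ - 1) + Complex.digamma z) := by
  have hκ' : (1 : ℝ) ≤ κ := by exact_mod_cast hκ
  have diffG : ∀ w : ℂ, 0 < w.re → DifferentiableAt ℂ Complex.Gamma w := fun w hw =>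
    Complex.differentiableAt_Gamma _ fun m hm => by
      have : 0 < (-(m : ℂ)).re := hm ▸ hw
      simp at this
      linarith [(Nat.cast_nonneg m : (0 : ℝ) ≤ m)]
  have ra : 0 < (κ - z : ℂ).re := by simp; linarith
  have rb : 0 < (1 - z : ℂ).re := by simp; linarith
  have rc : 0 < (z + κ - 1 : ℂ).re := by simp; linarith
  have hpi : (2 * (Real.pi : ℂ)) ≠ 0 := by simp [Real.pi_ne_zero]
  have ia : HasDerivAt (fun z : ℂ => (κ - z : ℂ)) (-1) z := (hasDerivAt_id z).const_sub _
  have ib : HasDerivAt (fun z : ℂ => (1 - z : ℂ)) (-1) z := (hasDerivAt_id z).const_sub _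
  have ic : HasDerivAt (fun z : ℂ => (z + κ - 1 : ℂ)) 1 z :=
    ((hasDerivAt_id z).add_const _).sub_const _
  have ip : HasDerivAt (fun z : ℂ => (2 * (Real.pi : ℂ)) ^ (4 * z - 2))
      ((2 * (Real.pi : ℂ)) ^ (4 * z - 2) * Complex.log (2 * Real.pi) * 4) z := by
    have : HasDerivAt (fun z : ℂ => 4 * z - 2) 4 z := by
      simpa using ((hasDerivAt_id z).const_mul (4 : ℂ)).sub_const 2
    exact this.const_cpow (Or.inl hpi)
  have da := (diffG _ ra).comp z ia.differentiableAt
  have db := (diffG _ rb).comp z ib.differentiableAt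
  have dc := (diffG _ rc).comp z ic.differentiableAt
  have na := Complex.Gamma_ne_zero_of_re_pos ra
  have nb := Complex.Gamma_ne_zero_of_re_pos rb
  have nc := Complex.Gamma_ne_zero_of_re_pos rc
  have nd := Complex.Gamma_ne_zero_of_re_pos h0
  have np : (2 * (Real.pi : ℂ)) ^ (4 * z - 2) ≠ 0 := by simp [Complex.cpow_eq_zero_iff, hpi]
  have la := logDeriv_comp (diffG _ ra) ia.differentiableAt
  have lb := logDeriv_comp (diffG _ rb) ib.differentiableAt
  have lc := logDeriv_comp (g := fun z : ℂ => z + κ - 1) (x := z) (diffG _ rc) ic.differentiableAt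
  have lp : logDeriv (fun z : ℂ => (2 * (Real.pi : ℂ)) ^ (4 * z - 2)) z =
      4 * Complex.log (2 * Real.pi) := by
    rw [logDeriv_apply, ip.deriv]
    field_simp
  rw [ia.deriv] at la
  rw [ib.deriv] at lb
  rw [ic.deriv] at lc
  have hX := logDeriv_mul_mul_div_mul (z := z)
    (p := fun w : ℂ => (2 * (Real.pi : ℂ)) ^ (4 * w - 2)) (a := Complex.Gamma ∘ fun w : ℂ => κ - w)
    (b := Complex.Gamma ∘ fun w : ℂ => 1 - w) (c := Complex.Gamma ∘ fun w : ℂ => w + κ - 1)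
    (d := Complex.Gamma) np na nb nc nd ip.differentiableAt da db dc (diffG _ h0)
  rw [lp, la, lb, lc] at hX
  refine hX.trans ?_
  simp only [Complex.digamma_def]
  ring

lemma deriv_logDeriv_RSX {κ : ℕ} (hκ : 0 < κ) {s : ℂ} (h0 : 0 < s.re) (h1 : s.re < 1) :
    deriv (logDeriv (RSX κ)) s =
      (∑' n : ℕ, ((κ - s + n) ^ 2)⁻¹) + (∑' n : ℕ, ((1 - s + n) ^ 2)⁻¹) -
        ((∑' n : ℕ, ((s + κ - 1 + n) ^ 2)⁻¹) + ∑' n : ℕ, ((s + n) ^ 2)⁻¹) := by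
  have hκ' : (1 : ℝ) ≤ κ := by exact_mod_cast hκ
  have ra : 0 < (κ - s : ℂ).re := by simp; linarith
  have rb : 0 < (1 - s : ℂ).re := by simp; linarith
  have rc : 0 < (s + κ - 1 : ℂ).re := by simp; linarith
  have ia : HasDerivAt (fun z : ℂ => (κ - z : ℂ)) (-1) s := (hasDerivAt_id s).const_sub _
  have ib : HasDerivAt (fun z : ℂ => (1 - z : ℂ)) (-1) s := (hasDerivAt_id s).const_sub _
  have ic : HasDerivAt (fun z : ℂ => (z + κ - 1 : ℂ)) 1 s :=
    ((hasDerivAt_id s).add_const _).sub_const _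
  have hd := ((((hasDerivAt_digamma ra).comp s ia).const_sub (4 * Complex.log (2 * Real.pi))).sub
    ((hasDerivAt_digamma rb).comp s ib)).sub
    (((hasDerivAt_digamma rc).comp s ic).add (hasDerivAt_digamma h0))
  have hev : logDeriv (RSX κ) =ᶠ[𝓝 s] fun z =>
      4 * Complex.log (2 * Real.pi) - Complex.digamma (κ - z) -
        Complex.digamma (1 - z) - (Complex.digamma (z + κ - 1) + Complex.digamma z) := by
    filter_upwards [(isOpen_lt continuous_const Complex.continuous_re).mem_nhds h0,
      (isOpen_lt Complex.continuous_re continuous_const).mem_nhds h1] with z hz0 hz1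
    exact logDeriv_RSX hκ hz0 hz1
  rw [hev.deriv_eq]
  refine hd.deriv.trans ?_
  ring

lemma norm_deriv_logDeriv_RSX {κ : ℕ} (hκ : 0 < κ) {v : ℝ} (hv : 3 ≤ v) :
    ‖deriv (logDeriv (RSX κ)) (1 / 2 + Complex.I * v)‖ =
      4 * v * ((∑' n : ℕ, ((κ - 1 : ℕ) + n + 1 / 2 : ℝ) /
          (((κ - 1 : ℕ) + n + 1 / 2) ^ 2 + v ^ 2) ^ 2) +
        ∑' n : ℕ, ((0 : ℕ) + n + 1 / 2 : ℝ) / (((0 : ℕ) + n + 1 / 2) ^ 2 + v ^ 2) ^ 2) := by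
  obtain ⟨k, rfl⟩ : ∃ k, κ = k + 1 := ⟨κ - 1, by lia⟩
  rw [Nat.add_sub_cancel, deriv_logDeriv_RSX hκ (by simp) (by simp; norm_num)]
  have e1 : ((k + 1 : ℕ) : ℂ) - (1 / 2 + Complex.I * v) =
      (starRingEnd ℂ) (k + 1 / 2 + Complex.I * v) := by
    simp [map_ofNat (starRingEnd ℂ) 2]
    ring
  have e2 : 1 - (1 / 2 + Complex.I * v) =
      (starRingEnd ℂ) ((0 : ℕ) + 1 / 2 + Complex.I * v) := by
    simp [map_ofNat (starRingEnd ℂ) 2]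
    ring
  have e3 : 1 / 2 + Complex.I * v + ((k + 1 : ℕ) : ℂ) - 1 = k + 1 / 2 + Complex.I * v := by
    push_cast
    ring
  have e4 : 1 / 2 + Complex.I * v = (0 : ℕ) + 1 / 2 + Complex.I * v := by simp
  rw [e1, e2, e3, e4, tsum_inv_conj_add_natCast_sq, tsum_inv_conj_add_natCast_sq, ← map_add,
    ← neg_sub, norm_neg, Complex.sub_conj, norm_mul, Complex.norm_I, mul_one, Complex.norm_real,
    Complex.add_im, im_tsum_inv_add_natCast_sq, im_tsum_inv_add_natCast_sq, Real.norm_eq_abs]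
  have p1 : 0 ≤ ∑' n : ℕ, (k + n + 1 / 2 : ℝ) / ((k + n + 1 / 2) ^ 2 + v ^ 2) ^ 2 :=
    tsum_nonneg fun n => by positivity
  have p2 := (le_tsum_div_sq hv).trans' (by positivity : 0 ≤ 1 / 4 * (1 / v ^ 2))
  generalize ∑' n : ℕ, (k + n + 1 / 2 : ℝ) / ((k + n + 1 / 2) ^ 2 + v ^ 2) ^ 2 = a at p1 ⊢
  generalize ∑' n : ℕ, ((0 : ℕ) + n + 1 / 2 : ℝ) / (((0 : ℕ) + n + 1 / 2) ^ 2 + v ^ 2) ^ 2 = b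
    at p2 ⊢
  rw [← abs_neg, abs_of_nonneg]
  · ring
  · have : 0 ≤ v * (a + b) := by positivity
    linarith

/-- Intermediate claim in the proof of Lemma 3: on the critical line the second derivative
of `log X` satisfies `(X'/X)'(1/2+iv) ≍ 1/v`. -/
theorem rankin_selberg_log_deriv_second_derivative (κ : ℕ) (hκ : 0 < κ) :
    ∃ c₁ c₂ : ℝ, 0 < c₁ ∧ 0 < c₂ ∧ ∀ v : ℝ, 3 ≤ v →
      c₁ / v ≤ ‖deriv (fun z : ℂ => deriv (RSX κ) z / RSX κ z) (1 / 2 + Complex.I * v)‖ ∧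
      ‖deriv (fun z : ℂ => deriv (RSX κ) z / RSX κ z) (1 / 2 + Complex.I * v)‖ ≤ c₂ / v := by
  refine ⟨1, 8, one_pos, by norm_num, fun v hv => ?_⟩
  have hv0 : 0 < v := by linarith
  have h := norm_deriv_logDeriv_RSX hκ hv
  change ‖deriv (fun z : ℂ => deriv (RSX κ) z / RSX κ z) (1 / 2 + Complex.I * v)‖ = _ at h
  rw [h]
  have p1 : 0 ≤ ∑' n : ℕ, ((κ - 1 : ℕ) + n + 1 / 2 : ℝ) /
      (((κ - 1 : ℕ) + n + 1 / 2) ^ 2 + v ^ 2) ^ 2 := tsum_nonneg fun n => by positivity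
  have u1 := tsum_div_sq_le (κ - 1) hv
  have u2 := tsum_div_sq_le 0 hv
  have l2 := le_tsum_div_sq hv
  constructor
  · calc 1 / v = 4 * v * (0 + 1 / 4 * (1 / v ^ 2)) := by field_simp; ring
      _ ≤ _ := by gcongr
  · calc _ ≤ 4 * v * (1 / v ^ 2 + 1 / v ^ 2) := by gcongr
      _ = 8 / v := by field_simp; ring
end
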